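/- Let d ≥ 2, α ∈ ℝ^d and c > 0 be fixed. Define, for measurable f ≥ 0 and x ∈ (0,∞)^d, V^α f(x) = χ_{[1,∞)^d}(x) · (∏_{i=1}^d x_i^{−2α_i−1}) e^{|x|²} ∫_{(0,∞)^d} exp(−c |x|² θ(x,y)²) f(y) dν_α(y). Then there is a constant C (depending only on d, α, c) such that ν_α{x ∈ (0,∞)^d : V^α f(x) > λ} ≤ (C/λ) ∫_{(0,∞)^d} f dν_α for every λ > 0 and every 0 ≤ f ∈ L¹(dν_α). -/

import Mathlib

open MeasureTheory

/-- The measure `ν_α` on `(0,∞)^d` with density `(∏ x_i^{2α_i+1}) e^{−|x|²}`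
with respect to Lebesgue measure. -/
noncomputable def nu (d : ℕ) (α : Fin d → ℝ) : Measure (Fin d → ℝ) :=
  ((volume : Measure (Fin d → ℝ)).withDensity fun x =>
    ENNReal.ofReal ((∏ i, x i ^ (2 * α i + 1)) * Real.exp (-∑ i, x i ^ 2))).restrict
    {x | ∀ i, 0 < x i}

/-- The Euclidean norm of `x ∈ ℝ^d`. -/
noncomputable def enr (d : ℕ) (x : Fin d → ℝ) : ℝ :=
  Real.sqrt (∑ i, x i ^ 2)

/-- The angle `θ(x,y) = arccos(⟨x,y⟩/(|x||y|))` between `x` and `y`. -/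
noncomputable def theta (d : ℕ) (x y : Fin d → ℝ) : ℝ :=
  Real.arccos ((∑ i, x i * y i) / (enr d x * enr d y))


lemma polar_lintegral {E : Type*} [NormedAddCommGroup E] [NormedSpace ℝ E] [MeasurableSpace E]
    [BorelSpace E] [FiniteDimensional ℝ E] [Nontrivial E] (μ : Measure E) [μ.IsAddHaarMeasure]
    (g : E → ENNReal) (hg : Measurable g) :
    ∫⁻ x, g x ∂μ = ∫⁻ w : Metric.sphere (0 : E) 1, (∫⁻ r in Set.Ioi (0 : ℝ),
      ENNReal.ofReal (r ^ (Module.finrank ℝ E - 1)) * g (r • (w : E))) ∂μ.toSphere := by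
  have h1 : ∫⁻ x, g x ∂μ = ∫⁻ x : ({(0)}ᶜ : Set E), g x ∂(μ.comap (↑)) := by
    rw [lintegral_subtype_comap (measurableSet_singleton _).compl,
        restrict_compl_singleton]
  have hm : Measurable (fun p : Metric.sphere (0 : E) 1 × Set.Ioi (0 : ℝ) =>
      g ((p.2 : ℝ) • (p.1 : E))) := by
    apply hg.comp
    exact (measurable_subtype_coe.comp measurable_snd).smul
      (measurable_subtype_coe.comp measurable_fst)
  have h2 := μ.measurePreserving_homeomorphUnitSphereProd.lintegral_comp hm
  rw [h1]
  rw [lintegral_prod _ hm.aemeasurable] at h2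
  have h3 : ∀ x : ({(0)}ᶜ : Set E), (((homeomorphUnitSphereProd E x).2 : ℝ)) •
      ((homeomorphUnitSphereProd E x).1 : E) = x := by
    intro x
    have hx : ‖(x : E)‖ ≠ 0 := norm_ne_zero_iff.2 x.2
    simp [smul_smul, hx]
  simp only [h3] at h2
  rw [h2]
  refine lintegral_congr fun w => ?_
  rw [Measure.volumeIoiPow, lintegral_withDensity_eq_lintegral_mul]
  · simp only [Pi.mul_apply]
    rw [lintegral_subtype_comap measurableSet_Ioi (fun r : ℝ =>
      ENNReal.ofReal (r ^ (Module.finrank ℝ E - 1)) * g (r • (w : E)))]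
  · fun_prop
  · exact hm.comp measurable_prodMk_left

lemma pow_exp_bound (c : ℝ) (hc : 0 < c) (m : ℕ) (t : ℝ) :
    t ^ m * Real.exp (-(c * t ^ 2)) ≤ 1 + m.factorial / c ^ m := by
  have h1 : t ^ m ≤ 1 + (t ^ 2) ^ m := by
    rw [← pow_mul, mul_comm, pow_mul]; nlinarith [sq_nonneg (t ^ m - 1), sq_nonneg (t^m)]
  have h2 := Real.pow_div_factorial_le_exp (c * t ^ 2) (by positivity) m
  have h3 : (t ^ 2) ^ m ≤ m.factorial / c ^ m * Real.exp (c * t ^ 2) := by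
    rw [div_le_iff₀ (by positivity), mul_pow] at h2
    rw [div_mul_eq_mul_div, le_div_iff₀ (by positivity)]
    linarith
  have h4 : 1 ≤ Real.exp (c * t ^ 2) := Real.one_le_exp (by positivity)
  rw [Real.exp_neg, ← div_eq_mul_inv, div_le_iff₀ (Real.exp_pos _)]
  nlinarith [h1, h3, h4]

lemma rpow_exp_bound (p : ℝ) : ∃ C : ℝ, 0 < C ∧ ∀ q : ℝ, 1 ≤ q →
    q ^ p ≤ C * Real.exp ((q ^ 2 - 1) / 2) := by
  obtain ⟨m, hm⟩ := exists_nat_ge p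
  refine ⟨(1 + m.factorial / (1/2 : ℝ) ^ m) * Real.exp (1/2), by positivity, fun q hq => ?_⟩
  have h1 : q ^ p ≤ q ^ m := by
    rw [← Real.rpow_natCast]; exact Real.rpow_le_rpow_of_exponent_le hq hm
  have h2 := pow_exp_bound (1/2) (by norm_num) m q
  rw [Real.exp_neg, ← div_eq_mul_inv, div_le_iff₀ (Real.exp_pos _)] at h2
  rw [mul_assoc, ← Real.exp_add]
  refine h1.trans (h2.trans (le_of_eq ?_))
  ring_nf

lemma tail_pt (p : ℝ) : ∃ C : ℝ, 0 < C ∧ ∀ a r₁ r : ℝ, 1 ≤ a → 1 ≤ r₁ → r₁ ≤ r →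
    r ^ p * Real.exp (-(a * r ^ 2)) ≤
      C * (r₁ ^ (p - 1) * Real.exp (-(a * r₁ ^ 2))) * (r * Real.exp (-((r ^ 2 - r₁ ^ 2) / 2))) := by
  obtain ⟨C, hC, h⟩ := rpow_exp_bound (p - 1)
  refine ⟨C, hC, fun a r₁ r ha h1 hr => ?_⟩
  have hr1 : 0 < r₁ := by linarith
  have hr0 : 0 < r := by linarith
  have hq := h (r / r₁) ((one_le_div hr1).2 hr)
  rw [Real.div_rpow hr0.le hr1.le, div_le_iff₀ (by positivity)] at hq
  have e1 : r ^ p = r ^ (p - 1) * r := by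
    rw [← Real.rpow_add_one hr0.ne']; simp
  have e2 : Real.exp (((r / r₁) ^ 2 - 1) / 2) * Real.exp (-(a * r ^ 2)) ≤
      Real.exp (-(a * r₁ ^ 2)) * Real.exp (-((r ^ 2 - r₁ ^ 2) / 2)) := by
    rw [← Real.exp_add, ← Real.exp_add]
    apply Real.exp_le_exp.2
    have : (r / r₁) ^ 2 - 1 ≤ r ^ 2 - r₁ ^ 2 := by
      rw [div_pow, div_sub_one (by positivity)]
      apply div_le_self
      · nlinarith
      · nlinarith
    have hD : 0 ≤ r ^ 2 - r₁ ^ 2 := by nlinarith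
    nlinarith [mul_nonneg (sub_nonneg.2 ha) hD]
  calc r ^ p * Real.exp (-(a * r ^ 2)) = r ^ (p - 1) * (r * Real.exp (-(a * r ^ 2))) := by
        rw [e1]; ring
    _ ≤ C * Real.exp (((r / r₁) ^ 2 - 1) / 2) * r₁ ^ (p - 1) * (r * Real.exp (-(a * r ^ 2))) := by
        gcongr
    _ = C * r₁ ^ (p - 1) * r * (Real.exp (((r / r₁) ^ 2 - 1) / 2) * Real.exp (-(a * r ^ 2))) := by
        ring
    _ ≤ C * r₁ ^ (p - 1) * r * (Real.exp (-(a * r₁ ^ 2)) * Real.exp (-((r ^ 2 - r₁ ^ 2) / 2))) := by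
        gcongr
    _ = _ := by ring

lemma tail_int1 (r₁ : ℝ) (h : 1 ≤ r₁) :
    ∫⁻ r in Set.Ioi r₁, ENNReal.ofReal (r * Real.exp (-((r ^ 2 - r₁ ^ 2) / 2))) = 1 := by
  have hd : ∀ x ∈ Set.Ici r₁, HasDerivAt (fun r => -Real.exp (-((r ^ 2 - r₁ ^ 2) / 2)))
      (x * Real.exp (-((x ^ 2 - r₁ ^ 2) / 2))) x := by
    intro x _
    have := ((((((hasDerivAt_id x).pow 2).sub_const (r₁ ^ 2)).div_const 2).neg).exp).neg
    refine this.congr_deriv ?_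
    simp; ring
  have hp : ∀ x ∈ Set.Ioi r₁, 0 ≤ x * Real.exp (-((x ^ 2 - r₁ ^ 2) / 2)) := by
    intro x hx
    have : 0 < x := by have := Set.mem_Ioi.1 hx; linarith
    positivity
  have ht : Filter.Tendsto (fun r => -Real.exp (-((r ^ 2 - r₁ ^ 2) / 2))) Filter.atTop
      (nhds 0) := by
    rw [← neg_zero]
    apply Filter.Tendsto.neg
    apply Real.tendsto_exp_neg_atTop_nhds_zero.comp
    apply Filter.Tendsto.atTop_div_const (by norm_num)
    apply Filter.tendsto_atTop_add_const_right
    exact Filter.tendsto_pow_atTop (by norm_num)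
  have h1 := integral_Ioi_of_hasDerivAt_of_nonneg' hd hp ht
  have h2 := integrableOn_Ioi_deriv_of_nonneg' hd hp ht
  rw [← ofReal_integral_eq_lintegral_ofReal h2, h1]
  · simp
  · filter_upwards [ae_restrict_mem measurableSet_Ioi] with x hx using hp x hx

lemma tail_int (p : ℝ) : ∃ C : ℝ, 0 < C ∧ ∀ a r₁ : ℝ, 1 ≤ a → 1 ≤ r₁ →
    ∫⁻ r in Set.Ioi r₁, ENNReal.ofReal (r ^ p * Real.exp (-(a * r ^ 2))) ≤
      ENNReal.ofReal (C * (r₁ ^ (p - 1) * Real.exp (-(a * r₁ ^ 2)))) := by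
  obtain ⟨C, hC, h⟩ := tail_pt p
  refine ⟨C, hC, fun a r₁ ha h1 => ?_⟩
  have h0 : 0 < r₁ := by linarith
  calc _ ≤ ∫⁻ r in Set.Ioi r₁, ENNReal.ofReal (C * (r₁ ^ (p - 1) * Real.exp (-(a * r₁ ^ 2)))) *
        ENNReal.ofReal (r * Real.exp (-((r ^ 2 - r₁ ^ 2) / 2))) := by
        refine setLIntegral_mono (by fun_prop) fun r hr => ?_
        rw [← ENNReal.ofReal_mul (by positivity)]
        exact ENNReal.ofReal_le_ofReal (h a r₁ r ha h1 (le_of_lt hr))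
    _ = _ := by
        rw [lintegral_const_mul _ (by fun_prop), tail_int1 r₁ h1, mul_one]

lemma lagrange_ge (d : ℕ) (x y : Fin d → ℝ) (i j : Fin d) :
    (x j * y i - x i * y j) ^ 2 ≤
      2 * ((∑ k, x k ^ 2) * (∑ k, y k ^ 2) - (∑ k, x k * y k) ^ 2) := by
  have h : ∑ k, ∑ l, (x k * y l - x l * y k) ^ 2 =
      2 * ((∑ k, x k ^ 2) * (∑ k, y k ^ 2) - (∑ k, x k * y k) ^ 2) := by
    have : ∀ k l, (x k * y l - x l * y k) ^ 2 =
        x k ^ 2 * y l ^ 2 + y k ^ 2 * x l ^ 2 - 2 * ((x k * y k) * (x l * y l)) := by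
      intros; ring
    simp only [this, Finset.sum_add_distrib, Finset.sum_sub_distrib, ← Finset.mul_sum,
      ← Finset.sum_mul]
    ring
  rw [← h]
  calc _ ≤ ∑ l, (x j * y l - x l * y j) ^ 2 :=
        Finset.single_le_sum (f := fun l => (x j * y l - x l * y j) ^ 2)
          (fun _ _ => sq_nonneg _) (Finset.mem_univ i)
    _ ≤ _ := Finset.single_le_sum (f := fun k => ∑ l, (x k * y l - x l * y k) ^ 2)
          (fun _ _ => Finset.sum_nonneg fun _ _ => sq_nonneg _) (Finset.mem_univ j)

lemma sumsq_pos (d : ℕ) (x : Fin d → ℝ) (hx : x ≠ 0) : 0 < ∑ k, x k ^ 2 := by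
  obtain ⟨k, hk⟩ := Function.ne_iff.1 hx
  exact Finset.sum_pos' (fun _ _ => sq_nonneg _) ⟨k, Finset.mem_univ _, by
    have : x k ≠ 0 := hk
    positivity⟩

lemma theta_lower (d : ℕ) (x y : Fin d → ℝ) (i j : Fin d) (hy : ∀ j, 0 < y j)
    (hmax : ∀ j, y j ≤ y i) (hx : ‖x‖ ≤ 1) (hx0 : x ≠ 0) :
    |x j - x i * (y j / y i)| ≤ 2 * d * theta d x y := by
  have hA : 0 < ∑ k, x k ^ 2 := sumsq_pos d x hx0
  have hB : 0 < ∑ k, y k ^ 2 := sumsq_pos d y (fun h => by have := hy i; simp [h] at this)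
  have hL := lagrange_ge d x y i j
  have hAd : ∑ k, x k ^ 2 ≤ d := by
    calc ∑ k, x k ^ 2 ≤ ∑ k : Fin d, (1 : ℝ) := by
          refine Finset.sum_le_sum fun k _ => ?_
          have := (norm_le_pi_norm x k).trans hx
          rw [Real.norm_eq_abs] at this
          rw [← sq_abs]; nlinarith [abs_nonneg (x k)]
      _ = d := by simp
  have hBd : ∑ k, y k ^ 2 ≤ d * y i ^ 2 := by
    calc ∑ k, y k ^ 2 ≤ ∑ k : Fin d, y i ^ 2 := by
          refine Finset.sum_le_sum fun k _ => ?_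
          have := hy k; have := hmax k
          gcongr
      _ = d * y i ^ 2 := by simp
  have hs : Real.sin (theta d x y) ≤ theta d x y := Real.sin_le (Real.arccos_nonneg _)
  have hd : (0 : ℝ) < d := by linarith
  refine le_trans ?_ (mul_le_mul_of_nonneg_left hs (by positivity))
  have hyi := hy i
  rw [theta, Real.sin_arccos, enr, enr, ← div_le_iff₀' (by positivity)]
  apply Real.le_sqrt_of_sq_le
  rw [div_pow, div_pow, sq_abs, mul_pow, mul_pow, Real.sq_sqrt hA.le, Real.sq_sqrt hB.le]
  set A := ∑ k, x k ^ 2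
  set B := ∑ k, y k ^ 2
  set P := ∑ k, x k * y k
  have e : (x j - x i * (y j / y i)) ^ 2 = (x j * y i - x i * y j) ^ 2 / y i ^ 2 := by
    field_simp
  have hAB : A * B ≤ d ^ 2 * y i ^ 2 := by
    calc A * B ≤ d * (d * y i ^ 2) := by gcongr
      _ = _ := by ring
  have hABP : 0 ≤ A * B - P ^ 2 := by nlinarith [sq_nonneg (x j * y i - x i * y j)]
  rw [e, one_sub_div (by positivity), div_div]
  calc _ ≤ (2 * (A * B - P ^ 2)) / (y i ^ 2 * (2 ^ 2 * d ^ 2)) := by gcongr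
    _ ≤ (4 * (A * B - P ^ 2)) / (4 * (d ^ 2 * y i ^ 2)) := by
        rw [show y i ^ 2 * (2 ^ 2 * (d : ℝ) ^ 2) = 4 * (d ^ 2 * y i ^ 2) by ring]
        gcongr; norm_num
    _ = (A * B - P ^ 2) / (d ^ 2 * y i ^ 2) := by rw [mul_div_mul_left _ _ (by norm_num)]
    _ ≤ _ := by gcongr

lemma enr_meas (d : ℕ) : Measurable (enr d) := by unfold enr; fun_prop

lemma theta_meas {β : Type*} [MeasurableSpace β] (d : ℕ) (u v : β → Fin d → ℝ)
    (hu : Measurable u) (hv : Measurable v) : Measurable (fun b => theta d (u b) (v b)) := by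
  unfold theta
  have h1 : Measurable (fun p => enr d (u p)) := (enr_meas d).comp hu
  have h2 : Measurable (fun p => enr d (v p)) := (enr_meas d).comp hv
  apply Real.measurable_arccos.comp
  apply Measurable.div
  · fun_prop
  · exact h1.mul h2

lemma enr_smul (d : ℕ) (r : ℝ) (hr : 0 < r) (x : Fin d → ℝ) : enr d (r • x) = r * enr d x := by
  unfold enr
  simp only [Pi.smul_apply, smul_eq_mul, mul_pow, ← Finset.mul_sum]
  rw [Real.sqrt_mul (by positivity), Real.sqrt_sq hr.le]

lemma theta_smul (d : ℕ) (r : ℝ) (hr : 0 < r) (x y : Fin d → ℝ) :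
    theta d (r • x) y = theta d x y := by
  unfold theta
  rw [enr_smul d r hr]
  simp only [Pi.smul_apply, smul_eq_mul, mul_assoc, ← Finset.mul_sum]
  rw [mul_div_mul_left _ _ hr.ne']

/-- the singular kernel -/
noncomputable def kk (d : ℕ) (x y : Fin d → ℝ) : ENNReal :=
  (ENNReal.ofReal (theta d x y) ^ (d - 2))⁻¹

lemma kk_meas {β : Type*} [MeasurableSpace β] (d : ℕ) (u v : β → Fin d → ℝ)
    (hu : Measurable u) (hv : Measurable v) : Measurable (fun b => kk d (u b) (v b)) := by
  unfold kk
  exact ((theta_meas d u v hu hv).ennreal_ofReal.pow_const _).inv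

/-- model kernel -/
noncomputable def k0 (n : ℕ) (D : ℝ) (v : Fin n → ℝ) : ENNReal :=
  (Metric.ball (0 : Fin n → ℝ) 2).indicator
    (fun v => (ENNReal.ofReal (‖v‖ / D) ^ (n - 1))⁻¹) v

lemma k0_meas (n : ℕ) (D : ℝ) : Measurable (k0 n D) := by
  unfold k0
  refine Measurable.indicator ?_ measurableSet_ball
  fun_prop

lemma k0_int (n : ℕ) (hn : 1 ≤ n) (D : ℝ) (hD : 0 < D) : ∫⁻ v, k0 n D v ≠ ⊤ := by
  have : Nonempty (Fin n) := ⟨⟨0, hn⟩⟩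
  rw [polar_lintegral _ _ (k0_meas n D)]
  have h : ∀ w : Metric.sphere (0 : Fin n → ℝ) 1, (∫⁻ r in Set.Ioi (0 : ℝ),
      ENNReal.ofReal (r ^ (Module.finrank ℝ (Fin n → ℝ) - 1)) * k0 n D (r • (w : Fin n → ℝ))) ≤
      ENNReal.ofReal (D ^ (n - 1)) * 2 := by
    intro w
    have hw : ‖(w : Fin n → ℝ)‖ = 1 := by simpa using w.2
    calc _ ≤ ∫⁻ r in Set.Ioi (0 : ℝ), (Set.Ioo (0 : ℝ) 2).indicator
          (fun _ => ENNReal.ofReal (D ^ (n - 1))) r := by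
          refine setLIntegral_mono' measurableSet_Ioi fun r hr => ?_
          have hr : 0 < r := hr
          have hrn : ‖r • (w : Fin n → ℝ)‖ = r := by
            rw [norm_smul, hw, mul_one, Real.norm_eq_abs, abs_of_pos hr]
          by_cases h2 : r < 2
          · rw [k0, Set.indicator_of_mem (by simpa [hrn] using h2),
              Set.indicator_of_mem (show r ∈ Set.Ioo (0 : ℝ) 2 from ⟨hr, h2⟩), hrn]
            rw [← ENNReal.ofReal_pow (by positivity), ← ENNReal.ofReal_inv_of_pos (by positivity),
              ← ENNReal.ofReal_mul (by positivity)]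
            apply ENNReal.ofReal_le_ofReal
            simp only [Module.finrank_fintype_fun_eq_card, Fintype.card_fin]
            apply le_of_eq
            rw [div_pow]; field_simp
          · rw [k0, Set.indicator_of_notMem (by simpa [hrn] using h2)]
            simp
      _ ≤ ∫⁻ r, (Set.Ioo (0 : ℝ) 2).indicator (fun _ => ENNReal.ofReal (D ^ (n - 1))) r :=
          setLIntegral_le_lintegral _ _
      _ = _ := by
          rw [lintegral_indicator measurableSet_Ioo]; simp
  refine ne_top_of_le_ne_top ?_ (lintegral_mono h)
  rw [lintegral_const]
  exact ENNReal.mul_ne_top (by finiteness) (measure_ne_top _ _)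

lemma kk_ball (n : ℕ) (hn : 1 ≤ n) (y : Fin (n + 1) → ℝ) (hy : ∀ i, 0 < y i) :
    ∫⁻ x in Metric.ball (0 : Fin (n + 1) → ℝ) 1, kk (n + 1) x y ≤
      2 * ∫⁻ v, k0 n (2 * (n + 1)) v := by
  obtain ⟨i, hi⟩ := Finite.exists_max y
  set D : ℝ := 2 * (n + 1) with hD
  have hD0 : 0 < D := by positivity
  set t : Fin n → ℝ := fun j => y (i.succAbove j) / y i with ht
  have htn : ‖t‖ ≤ 1 := by
    rw [pi_norm_le_iff_of_nonneg zero_le_one]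
    intro j
    rw [Real.norm_eq_abs, abs_of_pos (div_pos (hy _) (hy _))]
    exact (div_le_one (hy i)).2 (hi _)
  set H : ℝ × (Fin n → ℝ) → ENNReal := fun p =>
    (Set.Ioo (-1 : ℝ) 1).indicator (fun _ => 1) p.1 * k0 n D (p.2 - p.1 • t) with hH
  have hHm : Measurable H := by
    apply Measurable.mul
    · exact (measurable_const.indicator measurableSet_Ioo).comp measurable_fst
    · exact (k0_meas n D).comp (by fun_prop)
  have hle : ∀ x ∈ Metric.ball (0 : Fin (n + 1) → ℝ) 1, x ≠ 0 → kk (n + 1) x y ≤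
      H (MeasurableEquiv.piFinSuccAbove (fun _ : Fin (n + 1) => ℝ) i x) := by
    intro x hx hx0
    have hx1 : ‖x‖ < 1 := by simpa using hx
    have e : MeasurableEquiv.piFinSuccAbove (fun _ : Fin (n + 1) => ℝ) i x =
      (x i, fun j => x (i.succAbove j)) := rfl
    have hxi : |x i| < 1 := (norm_le_pi_norm x i).trans_lt hx1
    rw [e]
    simp only [hH]
    rw [Set.indicator_of_mem (show x i ∈ Set.Ioo (-1 : ℝ) 1 from abs_lt.1 hxi), one_mul]
    set v : Fin n → ℝ := (fun j => x (i.succAbove j)) - x i • t with hv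
    have hv2 : v ∈ Metric.ball (0 : Fin n → ℝ) 2 := by
      rw [mem_ball_zero_iff]
      have h1 : ‖(fun j => x (i.succAbove j))‖ < 1 := by
        rw [pi_norm_lt_iff zero_lt_one]
        intro j
        exact (norm_le_pi_norm x _).trans_lt hx1
      have h2 : ‖x i • t‖ ≤ 1 := by
        rw [norm_smul, Real.norm_eq_abs]
        nlinarith [norm_nonneg t, abs_nonneg (x i)]
      have := norm_sub_le (fun j => x (i.succAbove j)) (x i • t)
      linarith
    rw [k0, Set.indicator_of_mem hv2, kk]
    have hth : ‖v‖ / D ≤ theta (n + 1) x y := by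
      rw [div_le_iff₀' hD0]
      have h0 : 0 ≤ theta (n + 1) x y := Real.arccos_nonneg _
      rw [pi_norm_le_iff_of_nonneg (by positivity)]
      intro j
      have := theta_lower (n + 1) x y i (i.succAbove j) hy hi hx1.le hx0
      push_cast at this
      exact this
    apply ENNReal.inv_le_inv.2
    rw [show n + 1 - 2 = n - 1 by omega]
    gcongr
  calc _ ≤ ∫⁻ x in Metric.ball (0 : Fin (n + 1) → ℝ) 1,
        H (MeasurableEquiv.piFinSuccAbove (fun _ : Fin (n + 1) => ℝ) i x) := by
        refine lintegral_mono_ae ?_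
        have h0 : ∀ᵐ x : Fin (n + 1) → ℝ, x ≠ 0 := by
          rw [ae_iff]; simp
        filter_upwards [ae_restrict_mem measurableSet_ball, ae_restrict_of_ae h0] with x h1 h2
        exact hle x h1 h2
    _ ≤ ∫⁻ x, H (MeasurableEquiv.piFinSuccAbove (fun _ : Fin (n + 1) => ℝ) i x) :=
        setLIntegral_le_lintegral _ _
    _ = ∫⁻ p, H p := (volume_preserving_piFinSuccAbove (fun _ : Fin (n + 1) => ℝ) i).lintegral_comp hHm
    _ = ∫⁻ a, ∫⁻ u, H (a, u) := by
        rw [Measure.volume_eq_prod, lintegral_prod _ hHm.aemeasurable]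
    _ = ∫⁻ a : ℝ, (Set.Ioo (-1 : ℝ) 1).indicator (fun _ => 1) a * ∫⁻ v, k0 n D v := by
        refine lintegral_congr fun a => ?_
        simp only [hH]
        have hm : Measurable (fun u : Fin n → ℝ => k0 n D (u - a • t)) :=
          (k0_meas n D).comp (by fun_prop)
        rw [lintegral_const_mul _ hm,
          lintegral_sub_right_eq_self (fun u => k0 n D u)]
    _ = _ := by
        rw [lintegral_mul_const _ (measurable_const.indicator measurableSet_Ioo),
          lintegral_indicator measurableSet_Ioo]
        simp
        norm_num

lemma kk_smul (d : ℕ) (r : ℝ) (hr : 0 < r) (x y : Fin d → ℝ) : kk d (r • x) y = kk d x y := by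
  rw [kk, theta_smul d r hr, kk]

lemma c0_pos (n : ℕ) : ∫⁻ r in Set.Ioo (0 : ℝ) 1, ENNReal.ofReal (r ^ n) ≠ 0 := by
  refine ((setLIntegral_pos_iff (by fun_prop)).2 ?_).ne'
  have : Function.support (fun r : ℝ => ENNReal.ofReal (r ^ n)) ∩ Set.Ioo (0 : ℝ) 1 =
      Set.Ioo (0 : ℝ) 1 := by
    apply Set.inter_eq_right.2
    intro r hr
    have := pow_pos hr.1 n
    simp [this]
  rw [this]; simp

lemma kk_sphere_aux (n : ℕ) (y : Fin (n + 1) → ℝ) :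
    (∫⁻ w : Metric.sphere (0 : Fin (n + 1) → ℝ) 1, kk (n + 1) w y
        ∂(volume : Measure (Fin (n + 1) → ℝ)).toSphere) *
      (∫⁻ r in Set.Ioo (0 : ℝ) 1, ENNReal.ofReal (r ^ n)) ≤
      ∫⁻ x in Metric.ball (0 : Fin (n + 1) → ℝ) 1, kk (n + 1) x y := by
  have hkm : Measurable (fun x => kk (n + 1) x y) :=
    kk_meas (n + 1) (fun x => x) (fun _ => y) measurable_id measurable_const
  have hkm2 : Measurable (fun w : Metric.sphere (0 : Fin (n + 1) → ℝ) 1 =>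
      kk (n + 1) (w : Fin (n + 1) → ℝ) y) :=
    kk_meas (n + 1) Subtype.val (fun _ => y) measurable_subtype_coe measurable_const
  rw [← lintegral_indicator measurableSet_ball,
    polar_lintegral _ _ (hkm.indicator measurableSet_ball), ← lintegral_mul_const _ hkm2]
  refine lintegral_mono fun w => ?_
  have hw : ‖(w : Fin (n + 1) → ℝ)‖ = 1 := mem_sphere_zero_iff_norm.1 w.2
  have hm3 : Measurable (fun r : ℝ => ENNReal.ofReal (r ^ n)) := by fun_prop
  rw [← lintegral_const_mul _ hm3, ← lintegral_indicator measurableSet_Ioo,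
    ← lintegral_indicator measurableSet_Ioi]
  refine lintegral_mono fun r => ?_
  by_cases h : r ∈ Set.Ioo (0 : ℝ) 1
  · have hrn : ‖r • (w : Fin (n + 1) → ℝ)‖ = r := by
      rw [norm_smul, hw, mul_one, Real.norm_eq_abs, abs_of_pos h.1]
    have hb : r • (w : Fin (n + 1) → ℝ) ∈ Metric.ball (0 : Fin (n + 1) → ℝ) 1 := by
      rw [mem_ball_zero_iff, hrn]; exact h.2
    rw [Set.indicator_of_mem h, Set.indicator_of_mem (show r ∈ Set.Ioi (0 : ℝ) from h.1),
      Set.indicator_of_mem hb, kk_smul _ _ h.1, Module.finrank_fintype_fun_eq_card,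
      Fintype.card_fin, Nat.add_sub_cancel, mul_comm]
  · rw [Set.indicator_of_notMem h]; exact zero_le

lemma kk_sphere (d : ℕ) (hd : 2 ≤ d) : ∃ C : ENNReal, C ≠ ⊤ ∧ ∀ y : Fin d → ℝ, (∀ i, 0 < y i) →
    ∫⁻ w : Metric.sphere (0 : Fin d → ℝ) 1, kk d w y ∂(volume : Measure (Fin d → ℝ)).toSphere
      ≤ C := by
  obtain ⟨n, rfl⟩ : ∃ n, d = n + 1 := ⟨d - 1, by omega⟩
  have hn : 1 ≤ n := by omega
  have hK : 2 * ∫⁻ v, k0 n (2 * (n + 1)) v ≠ ⊤ :=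
    ENNReal.mul_ne_top (by simp) (k0_int n hn _ (by positivity))
  refine ⟨(2 * ∫⁻ v, k0 n (2 * (n + 1)) v) /
    (∫⁻ r in Set.Ioo (0 : ℝ) 1, ENNReal.ofReal (r ^ n)), ?_, fun y hy => ?_⟩
  · exact ENNReal.div_ne_top hK (c0_pos n)
  rw [ENNReal.le_div_iff_mul_le (Or.inl (c0_pos n)) (Or.inr hK)]
  exact (kk_sphere_aux n y).trans (kk_ball n hn y hy)

/-- the level set -/
def levelSet (d : ℕ) (α : Fin d → ℝ) (c : ℝ) (ν : Measure (Fin d → ℝ))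
    (F : (Fin d → ℝ) → ENNReal) (lam : ℝ) : Set (Fin d → ℝ) :=
  {x | ENNReal.ofReal lam <
          Set.indicator {x : Fin d → ℝ | ∀ i, 1 ≤ x i}
            (fun x => ENNReal.ofReal
                ((∏ i, x i ^ (-(2 * α i + 1))) * Real.exp (enr d x ^ 2)) *
              ∫⁻ y, ENNReal.ofReal (Real.exp (-c * enr d x ^ 2 * theta d x y ^ 2)) *
                F y ∂ν) x}

lemma levelSet_meas (d : ℕ) (α : Fin d → ℝ) (c : ℝ) (ν : Measure (Fin d → ℝ)) [SFinite ν]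
    (F : (Fin d → ℝ) → ENNReal) (hF : Measurable F) (lam : ℝ) :
    MeasurableSet (levelSet d α c ν F lam) := by
  unfold levelSet
  apply measurableSet_lt measurable_const
  apply Measurable.indicator
  · have h1 := enr_meas d
    apply Measurable.mul
    · fun_prop
    · have h2 : Measurable (fun p : (Fin d → ℝ) × (Fin d → ℝ) => enr d p.1) :=
        h1.comp measurable_fst
      have h3 : Measurable (fun p : (Fin d → ℝ) × (Fin d → ℝ) => theta d p.1 p.2) :=
        theta_meas d Prod.fst Prod.snd measurable_fst measurable_snd
      have h4 : Measurable (fun p : (Fin d → ℝ) × (Fin d → ℝ) =>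
          ENNReal.ofReal (Real.exp (-c * enr d p.1 ^ 2 * theta d p.1 p.2 ^ 2)) * F p.2) := by
        have h5 : Measurable (fun p : (Fin d → ℝ) × (Fin d → ℝ) => F p.2) := hF.comp measurable_snd
        fun_prop
      exact h4.lintegral_prod_right'
  · have : {x : Fin d → ℝ | ∀ i, 1 ≤ x i} = ⋂ i, {x | 1 ≤ x i} := by ext; simp
    rw [this]
    exact MeasurableSet.iInter fun i => measurableSet_le measurable_const (measurable_pi_apply i)

/-- the density -/
noncomputable def dens (d : ℕ) (α : Fin d → ℝ) (x : Fin d → ℝ) : ENNReal :=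
    ENNReal.ofReal ((∏ i, x i ^ (2 * α i + 1)) * Real.exp (-∑ i, x i ^ 2))

lemma dens_meas (d : ℕ) (α : Fin d → ℝ) : Measurable (dens d α) := by
  unfold dens; fun_prop

lemma prod_smul_rpow (d : ℕ) (β : Fin d → ℝ) (r : ℝ) (hr : 0 < r) (w : Fin d → ℝ)
    (hw : ∀ i, 0 < w i) : ∏ i, (r • w) i ^ β i = r ^ (∑ i, β i) * ∏ i, w i ^ β i := by
  rw [Real.rpow_sum_of_pos hr, ← Finset.prod_mul_distrib]
  refine Finset.prod_congr rfl fun i _ => ?_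
  rw [Pi.smul_apply, smul_eq_mul, Real.mul_rpow hr.le (hw i).le]

lemma kk_bound (d : ℕ) (c : ℝ) (hc : 0 < c) (r a : ℝ) (hr : 0 < r) (ha : 1 ≤ a)
    (w y : Fin d → ℝ) :
    ENNReal.ofReal (r ^ (d - 2)) *
      ENNReal.ofReal (Real.exp (-c * (a * r ^ 2) * theta d w y ^ 2)) ≤
      ENNReal.ofReal (1 + (d - 2).factorial / c ^ (d - 2)) * kk d w y := by
  have h0 : 0 ≤ theta d w y := Real.arccos_nonneg _
  have hC : 0 < 1 + (d - 2).factorial / c ^ (d - 2) := by positivity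
  rw [kk, ← div_eq_mul_inv, ENNReal.le_div_iff_mul_le (Or.inr (by simpa using hC))
    (Or.inr (by simp)), ← ENNReal.ofReal_pow h0, ← ENNReal.ofReal_mul (by positivity),
    ← ENNReal.ofReal_mul (by positivity)]
  apply ENNReal.ofReal_le_ofReal
  have h := pow_exp_bound c hc (d - 2) (r * theta d w y)
  refine le_trans ?_ h
  rw [mul_pow r (theta d w y) (d - 2), mul_right_comm]
  gcongr
  rw [mul_pow]
  have : 0 ≤ c * (r ^ 2 * theta d w y ^ 2) := by positivity
  nlinarith

lemma ray (d : ℕ) (hd : 2 ≤ d) (α : Fin d → ℝ) (c : ℝ) (hc : 0 < c) : ∃ C : ℝ, 0 < C ∧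
    ∀ (ν : Measure (Fin d → ℝ)) (F : (Fin d → ℝ) → ENNReal) (lam : ℝ), 0 < lam →
    ∀ w : Fin d → ℝ, ‖w‖ = 1 →
    ∫⁻ r in Set.Ioi (0 : ℝ), ENNReal.ofReal (r ^ (d - 1)) *
      (levelSet d α c ν F lam).indicator (dens d α) (r • w) ≤
      ENNReal.ofReal (C / lam) * ∫⁻ y, kk d w y * F y ∂ν := by
  set s : ℝ := ∑ i, (2 * α i + 1) with hs
  obtain ⟨Ct, hCt, htail⟩ := tail_int (s + (d - 1 : ℕ))
  set C' : ℝ := 1 + (d - 2).factorial / c ^ (d - 2) with hC'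
  have hC'0 : 0 < C' := by positivity
  refine ⟨Ct * C', by positivity, fun ν F lam hlam w hw => ?_⟩
  set M := ∫⁻ y, kk d w y * F y ∂ν with hM
  set A : Set ℝ := {r | 0 < r ∧ r • w ∈ levelSet d α c ν F lam} with hA
  rcases A.eq_empty_or_nonempty with hAe | hAne
  · have : ∫⁻ r in Set.Ioi (0 : ℝ), ENNReal.ofReal (r ^ (d - 1)) *
      (levelSet d α c ν F lam).indicator (dens d α) (r • w) = 0 := by
      rw [← lintegral_zero]
      refine setLIntegral_congr_fun measurableSet_Ioi fun r hr => ?_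
      have : r ∉ A := by rw [hAe]; simp
      have h2 : r • w ∉ levelSet d α c ν F lam := fun h => this ⟨hr, h⟩
      simp [Set.indicator_of_notMem h2]
    rw [this]; exact zero_le
  set a : ℝ := ∑ i, w i ^ 2 with ha
  have ha1 : 1 ≤ a := by
    have : ‖w‖ ≤ Real.sqrt a := by
      rw [pi_norm_le_iff_of_nonneg (Real.sqrt_nonneg _)]
      intro i
      apply Real.le_sqrt_of_sq_le
      rw [Real.norm_eq_abs, sq_abs]
      exact Finset.single_le_sum (f := fun i => w i ^ 2) (fun _ _ => sq_nonneg _)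
        (Finset.mem_univ i)
    rw [hw] at this
    exact Real.one_le_sqrt.1 this
  have hsum : ∀ r : ℝ, ∑ i, (r • w) i ^ 2 = a * r ^ 2 := by
    intro r
    simp only [Pi.smul_apply, smul_eq_mul, mul_pow, ← Finset.mul_sum]
    rw [mul_comm]
  have henr : ∀ r : ℝ, enr d (r • w) ^ 2 = a * r ^ 2 := by
    intro r
    rw [enr, Real.sq_sqrt (Finset.sum_nonneg fun _ _ => sq_nonneg _), hsum]
  have hge : ∀ r ∈ A, ∀ i, 1 ≤ r * w i := by
    intro r hr
    by_contra hcon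
    have h2 := hr.2
    simp only [levelSet, Set.mem_ofPred_eq] at h2
    rw [Set.indicator_of_notMem (by simpa using hcon)] at h2
    simp at h2
  have hwpos : ∀ i, 0 < w i := by
    obtain ⟨r, hr⟩ := hAne
    intro i
    have h1 := hge r hr i
    have h2 : 0 < r := hr.1
    by_contra hcon
    nlinarith
  have hA1 : ∀ r ∈ A, 1 ≤ r := by
    intro r hr
    have h1 := hge r hr ⟨0, by omega⟩
    have h2 : 0 < r := hr.1
    have h3 := norm_le_pi_norm w ⟨0, by omega⟩
    rw [hw, Real.norm_eq_abs] at h3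
    have h4 := (le_abs_self _).trans h3
    nlinarith
  set W : ℝ := ∏ i, w i ^ (2 * α i + 1) with hW
  have hW0 : 0 < W := Finset.prod_pos fun i _ => Real.rpow_pos_of_pos (hwpos i) _
  set Φ : ℝ → ℝ := fun r => lam * (W * (r ^ (s + (d - 1 : ℕ) - 1) * Real.exp (-(a * r ^ 2))))
    with hΦ
  have hΦA : ∀ r ∈ A, ENNReal.ofReal (Φ r) ≤ ENNReal.ofReal C' * M := by
    intro r hr
    have hr0 : 0 < r := hr.1
    have h2 := hr.2
    simp only [levelSet, Set.mem_ofPred_eq] at h2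
    rw [Set.indicator_of_mem (show r • w ∈ {x : Fin d → ℝ | ∀ i, 1 ≤ x i} from hge r hr)] at h2
    simp only [henr, theta_smul d r hr0] at h2
    have e1 : ∏ i, (r • w) i ^ (-(2 * α i + 1)) = (r ^ s * W)⁻¹ := by
      rw [← prod_smul_rpow d _ r hr0 w hwpos, ← Finset.prod_inv_distrib]
      refine Finset.prod_congr rfl fun i _ => ?_
      rw [Real.rpow_neg]
      exact (mul_pos hr0 (hwpos i)).le
    rw [e1] at h2
    set G := ∫⁻ y, ENNReal.ofReal (Real.exp (-c * (a * r ^ 2) * theta d w y ^ 2)) * F y ∂ν with hG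
    have e2 : Φ r = r ^ (d - 2) * (r ^ s * W * Real.exp (-(a * r ^ 2))) * lam := by
      simp only [hΦ]
      have : s + ((d - 1 : ℕ) : ℝ) - 1 = s + ((d - 2 : ℕ) : ℝ) := by
        obtain ⟨m, rfl⟩ : ∃ m, d = m + 2 := ⟨d - 2, by omega⟩
        rw [show m + 2 - 1 = m + 1 by omega, show m + 2 - 2 = m by omega]
        push_cast; ring
      rw [this, Real.rpow_add hr0, Real.rpow_natCast]
      ring
    have hQ : 0 < r ^ (d - 2) * (r ^ s * W * Real.exp (-(a * r ^ 2))) := by positivity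
    calc ENNReal.ofReal (Φ r) = ENNReal.ofReal (r ^ (d - 2) *
          (r ^ s * W * Real.exp (-(a * r ^ 2)))) * ENNReal.ofReal lam := by
          rw [e2, ENNReal.ofReal_mul hQ.le]
      _ ≤ ENNReal.ofReal (r ^ (d - 2) * (r ^ s * W * Real.exp (-(a * r ^ 2)))) *
          (ENNReal.ofReal ((r ^ s * W)⁻¹ * Real.exp (a * r ^ 2)) * G) := by
          gcongr
      _ = ENNReal.ofReal (r ^ (d - 2)) * G := by
          rw [← mul_assoc, ← ENNReal.ofReal_mul hQ.le]
          congr 2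
          rw [Real.exp_neg]
          have := Real.exp_pos (a * r ^ 2)
          have := Real.rpow_pos_of_pos hr0 s
          field_simp
      _ = ∫⁻ y, ENNReal.ofReal (r ^ (d - 2)) *
          (ENNReal.ofReal (Real.exp (-c * (a * r ^ 2) * theta d w y ^ 2)) * F y) ∂ν := by
          rw [hG, lintegral_const_mul' _ _ (by simp)]
      _ ≤ ∫⁻ y, ENNReal.ofReal C' * (kk d w y * F y) ∂ν := by
          refine lintegral_mono fun y => ?_
          have hk := kk_bound d c hc r a hr0 ha1 w y
          calc _ = (ENNReal.ofReal (r ^ (d - 2)) *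
                ENNReal.ofReal (Real.exp (-c * (a * r ^ 2) * theta d w y ^ 2))) * F y := by
                rw [mul_assoc (ENNReal.ofReal (r ^ (d - 2)))]
            _ ≤ (ENNReal.ofReal C' * kk d w y) * F y := by gcongr
            _ = _ := by rw [mul_assoc]
      _ = _ := by rw [lintegral_const_mul' _ _ (by simp)]
  set r₁ := sInf A with hr₁
  have hbdd : BddBelow A := ⟨1, hA1⟩
  have h1r : 1 ≤ r₁ := le_csInf hAne hA1
  have hΦ1 : ENNReal.ofReal (Φ r₁) ≤ ENNReal.ofReal C' * M := by
    have hcl : r₁ ∈ closure A := csInf_mem_closure hAne hbdd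
    have hcont : ContinuousAt (fun r => ENNReal.ofReal (Φ r)) r₁ := by
      refine ENNReal.continuous_ofReal.continuousAt.comp ?_
      have : ContinuousAt (fun r : ℝ => r ^ (s + (d - 1 : ℕ) - 1)) r₁ :=
        Real.continuousAt_rpow_const _ _ (Or.inl (by linarith))
      simp only [hΦ]
      fun_prop
    have := hcont.continuousWithinAt.mem_closure hcl
      (t := Set.Iic (ENNReal.ofReal C' * M)) (fun r hr => hΦA r hr)
    rwa [isClosed_Iic.closure_eq] at this
  calc _ ≤ ∫⁻ r in Set.Ioi (0 : ℝ), (Set.Ici r₁).indicator (fun r => ENNReal.ofReal W *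
        ENNReal.ofReal (r ^ (s + (d - 1 : ℕ)) * Real.exp (-(a * r ^ 2)))) r := by
        refine setLIntegral_mono' measurableSet_Ioi fun r hr => ?_
        have hr0 : 0 < r := hr
        by_cases h : r • w ∈ levelSet d α c ν F lam
        · have hrA : r ∈ A := ⟨hr0, h⟩
          rw [Set.indicator_of_mem h,
            Set.indicator_of_mem (show r ∈ Set.Ici r₁ from csInf_le hbdd hrA), dens, hsum,
            prod_smul_rpow d _ r hr0 w hwpos, ← ENNReal.ofReal_mul (by positivity),
            ← ENNReal.ofReal_mul hW0.le]
          apply le_of_eq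
          congr 1
          rw [Real.rpow_add hr0, Real.rpow_natCast]
          ring
        · rw [Set.indicator_of_notMem h, mul_zero]; exact zero_le
    _ ≤ ∫⁻ r, (Set.Ici r₁).indicator (fun r => ENNReal.ofReal W *
        ENNReal.ofReal (r ^ (s + (d - 1 : ℕ)) * Real.exp (-(a * r ^ 2)))) r :=
        setLIntegral_le_lintegral _ _
    _ = ENNReal.ofReal W * ∫⁻ r in Set.Ioi r₁,
        ENNReal.ofReal (r ^ (s + (d - 1 : ℕ)) * Real.exp (-(a * r ^ 2))) := by
        rw [lintegral_indicator measurableSet_Ici, lintegral_const_mul' _ _ (by simp),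
          setLIntegral_congr Ioi_ae_eq_Ici]
    _ ≤ ENNReal.ofReal W * ENNReal.ofReal (Ct * (r₁ ^ (s + (d - 1 : ℕ) - 1) *
          Real.exp (-(a * r₁ ^ 2)))) := by
        gcongr
        exact htail a r₁ ha1 h1r
    _ = ENNReal.ofReal (Ct / lam) * ENNReal.ofReal (Φ r₁) := by
        rw [← ENNReal.ofReal_mul hW0.le, ← ENNReal.ofReal_mul (by positivity)]
        congr 1
        simp only [hΦ]
        field_simp
    _ ≤ ENNReal.ofReal (Ct / lam) * (ENNReal.ofReal C' * M) := by gcongr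
    _ = _ := by
        rw [← mul_assoc, ← ENNReal.ofReal_mul (by positivity)]
        congr 2
        ring

lemma level_bound (d : ℕ) (hd : 2 ≤ d) (α : Fin d → ℝ) (c : ℝ) (hc : 0 < c) : ∃ C : ℝ, 0 < C ∧
    ∀ (F : (Fin d → ℝ) → ENNReal), Measurable F → ∀ (lam : ℝ), 0 < lam →
    nu d α (levelSet d α c (nu d α) F lam) ≤
      ENNReal.ofReal (C / lam) * ∫⁻ y, F y ∂(nu d α) := by
  obtain ⟨C, hC, hray⟩ := ray d hd α c hc
  obtain ⟨K, hK, hkk⟩ := kk_sphere d hd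
  have hSF : SFinite (nu d α) := by unfold nu; infer_instance
  have : Nonempty (Fin d) := ⟨⟨0, by omega⟩⟩
  refine ⟨C * (K.toReal + 1), by positivity, fun F hF lam hlam => ?_⟩
  set E := levelSet d α c (nu d α) F lam with hE
  have hEm : MeasurableSet E := levelSet_meas d α c (nu d α) F hF lam
  have hpos : ∀ᵐ y ∂(nu d α), ∀ i, 0 < y i := by
    have hms : MeasurableSet {x : Fin d → ℝ | ∀ i, 0 < x i} := by
      have : {x : Fin d → ℝ | ∀ i, 0 < x i} = ⋂ i, {x | 0 < x i} := by ext; simp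
      rw [this]
      exact MeasurableSet.iInter fun i =>
        measurableSet_lt measurable_const (measurable_pi_apply i)
    unfold nu
    exact ae_restrict_mem hms
  have hkm : Measurable (fun p : Metric.sphere (0 : Fin d → ℝ) 1 × (Fin d → ℝ) =>
      kk d p.1 p.2 * F p.2) :=
    (kk_meas d (fun p : Metric.sphere (0 : Fin d → ℝ) 1 × (Fin d → ℝ) => (p.1 : Fin d → ℝ))
      (fun p => p.2) (measurable_subtype_coe.comp measurable_fst) measurable_snd).mul
      (hF.comp measurable_snd)
  calc nu d α E ≤ ((volume : Measure (Fin d → ℝ)).withDensity (dens d α)) E :=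
        Measure.restrict_le_self E
    _ = ∫⁻ x, E.indicator (dens d α) x := by
        rw [withDensity_apply _ hEm, lintegral_indicator hEm]
    _ = ∫⁻ w : Metric.sphere (0 : Fin d → ℝ) 1, (∫⁻ r in Set.Ioi (0 : ℝ),
          ENNReal.ofReal (r ^ (d - 1)) * E.indicator (dens d α) (r • (w : Fin d → ℝ)))
          ∂(volume : Measure (Fin d → ℝ)).toSphere := by
        rw [polar_lintegral _ _ ((dens_meas d α).indicator hEm)]
        simp only [Module.finrank_fintype_fun_eq_card, Fintype.card_fin]
    _ ≤ ∫⁻ w : Metric.sphere (0 : Fin d → ℝ) 1, ENNReal.ofReal (C / lam) *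
          (∫⁻ y, kk d w y * F y ∂(nu d α)) ∂(volume : Measure (Fin d → ℝ)).toSphere := by
        refine lintegral_mono fun w => ?_
        exact hray (nu d α) F lam hlam w (mem_sphere_zero_iff_norm.1 w.2)
    _ = ENNReal.ofReal (C / lam) * ∫⁻ w : Metric.sphere (0 : Fin d → ℝ) 1,
          (∫⁻ y, kk d w y * F y ∂(nu d α)) ∂(volume : Measure (Fin d → ℝ)).toSphere := by
        rw [lintegral_const_mul' _ _ (by simp)]
    _ = ENNReal.ofReal (C / lam) * ∫⁻ y, (∫⁻ w : Metric.sphere (0 : Fin d → ℝ) 1,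
          kk d w y * F y ∂(volume : Measure (Fin d → ℝ)).toSphere) ∂(nu d α) := by
        rw [lintegral_lintegral_swap hkm.aemeasurable]
    _ ≤ ENNReal.ofReal (C / lam) * ∫⁻ y, ENNReal.ofReal (K.toReal + 1) * F y ∂(nu d α) := by
        refine mul_le_mul_right (lintegral_mono_ae ?_) _
        filter_upwards [hpos] with y hy
        have hkm2 : Measurable (fun w : Metric.sphere (0 : Fin d → ℝ) 1 => kk d w y) :=
          kk_meas d Subtype.val (fun _ => y) measurable_subtype_coe measurable_const
        rw [lintegral_mul_const _ hkm2]
        gcongr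
        refine (hkk y hy).trans ?_
        rw [← ENNReal.ofReal_toReal hK]
        apply ENNReal.ofReal_le_ofReal
        simp
    _ = _ := by
        rw [lintegral_const_mul' _ _ (by simp), ← mul_assoc, ← ENNReal.ofReal_mul (by positivity)]
        congr 2
        ring

/-- For fixed `d ≥ 2`, `α ∈ ℝ^d`, `c > 0`, the operator
`V^α f(x) = χ_{[1,∞)^d}(x) x^{−2α−1} e^{|x|²} ∫ exp(−c|x|²θ(x,y)²) f(y) dν_α(y)`
is of weak type `(1,1)` with respect to `ν_α`. -/
theorem stmt16 (d : ℕ) (hd : 2 ≤ d) (α : Fin d → ℝ) (c : ℝ) (hc : 0 < c) :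
    ∃ C : ℝ, 0 < C ∧ ∀ f : (Fin d → ℝ) → ℝ, (∀ x, 0 ≤ f x) →
      Integrable f (nu d α) → ∀ lam : ℝ, 0 < lam →
      nu d α {x | ENNReal.ofReal lam <
          Set.indicator {x : Fin d → ℝ | ∀ i, 1 ≤ x i}
            (fun x => ENNReal.ofReal
                ((∏ i, x i ^ (-(2 * α i + 1))) * Real.exp (enr d x ^ 2)) *
              ∫⁻ y, ENNReal.ofReal (Real.exp (-c * enr d x ^ 2 * theta d x y ^ 2)) *
                ENNReal.ofReal (f y) ∂(nu d α)) x} ≤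
        ENNReal.ofReal (C / lam * ∫ x, f x ∂(nu d α)) := by

  obtain ⟨C, hC, h⟩ := level_bound d hd α c hc
  refine ⟨C, hC, fun f hf hint lam hlam => ?_⟩
  have hae := hint.1.ae_eq_mk
  set F : (Fin d → ℝ) → ENNReal := fun y => ENNReal.ofReal (hint.1.mk f y) with hF
  have hFm : Measurable F := hint.1.stronglyMeasurable_mk.measurable.ennreal_ofReal
  have hFae : ∀ᵐ y ∂(nu d α), ENNReal.ofReal (f y) = F y := by
    filter_upwards [hae] with y hy
    rw [hF, hy]
  have hK : ∀ x, ∫⁻ y, ENNReal.ofReal (Real.exp (-c * enr d x ^ 2 * theta d x y ^ 2)) *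
      ENNReal.ofReal (f y) ∂(nu d α) =
      ∫⁻ y, ENNReal.ofReal (Real.exp (-c * enr d x ^ 2 * theta d x y ^ 2)) * F y ∂(nu d α) := by
    intro x
    refine lintegral_congr_ae ?_
    filter_upwards [hFae] with y hy
    rw [hy]
  have h1 := h F hFm lam hlam
  simp only [hK]
  rw [ENNReal.ofReal_mul (by positivity),
    ofReal_integral_eq_lintegral_ofReal hint (Filter.Eventually.of_forall hf),
    lintegral_congr_ae hFae]
  exact h1
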